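/- Let A ⇉ B (a string of left exact functors F : A → B and G : B → C between abelian categories) be such that A and B have enough injectives and F carries injective objects of A to G-acyclic objects of B. Then for every object A₀ of A there is a convergent first-quadrant spectral sequence E₂^{p,q} = R^p G (R^q F (A₀)) ⇒ R^{p+q}(G ∘ F)(A₀) (the Grothendieck spectral sequence). -/

import Mathlib

open CategoryTheory Limits

universe v u

/-- A convergent first-quadrant cohomological spectral sequence in an abelian
category `A`, with `E₂`-page `E₂ : ℕ → ℕ → A` and abutment `H : ℕ → A`:
pages `E_r^{p,q}` for `r ≥ 2` (indexed over `ℤ × ℤ`, vanishing outside the first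
quadrant), differentials `d_r` of bidegree `(r, 1-r)` squaring to zero, each page
being the homology of the previous one, a stable (`E_∞`) page, and a finite
filtration of each `H^n` by subobjects whose graded pieces are the
`E_∞^{p, n-p}`. -/
structure ConvergentFirstQuadrantSpectralSequence
    {A : Type u} [Category.{v} A] [Abelian A]
    (E₂ : ℕ → ℕ → A) (H : ℕ → A) where
  /-- the pages `E_r^{p,q}`, `r ≥ 2` -/
  page : ∀ (r : ℕ), 2 ≤ r → ℤ → ℤ → A
  /-- the second page is `E₂` -/
  pageTwo : ∀ p q : ℕ, page 2 le_rfl p q ≅ E₂ p q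
  /-- first-quadrant: pages vanish outside `p, q ≥ 0` -/
  vanish : ∀ (r : ℕ) (hr : 2 ≤ r) (p q : ℤ), p < 0 ∨ q < 0 → IsZero (page r hr p q)
  /-- the differentials `d_r : E_r^{p,q} ⟶ E_r^{p+r, q-r+1}` -/
  d : ∀ (r : ℕ) (hr : 2 ≤ r) (p q : ℤ), page r hr p q ⟶ page r hr (p + r) (q - r + 1)
  /-- `d_r ∘ d_r = 0` -/
  d_comp_d : ∀ (r : ℕ) (hr : 2 ≤ r) (p q : ℤ),
    d r hr p q ≫ d r hr (p + r) (q - r + 1) = 0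
  /-- the `(r+1)`-st page is the homology of the `r`-th page at the corresponding
  spot -/
  nextPage : ∀ (r : ℕ) (hr : 2 ≤ r) (hr' : 2 ≤ r + 1) (p q : ℤ)
    (h : page r hr (p - r + r) (q + r - 1 - r + 1) = page r hr p q)
    (w : (d r hr (p - r) (q + r - 1) ≫ eqToHom h) ≫ d r hr p q = 0),
    page (r + 1) hr' p q ≅
      (ShortComplex.mk (d r hr (p - r) (q + r - 1) ≫ eqToHom h) (d r hr p q)
        w).homology
  /-- the limit (`E_∞`) page -/
  Einf : ℤ → ℤ → A
  /-- the pages stabilise to `E_∞` -/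
  stab : ∀ p q : ℤ, ∃ (r₀ : ℕ) (_ : 2 ≤ r₀), ∀ (r : ℕ) (hr : 2 ≤ r),
    r₀ ≤ r → Nonempty (page r hr p q ≅ Einf p q)
  /-- the filtration `F^p H^n` of the abutment -/
  filt : (n : ℕ) → ℤ → Subobject (H n)
  /-- the filtration is decreasing -/
  filt_antitone : ∀ (n : ℕ) (p : ℤ), filt n (p + 1) ≤ filt n p
  /-- the filtration is exhaustive -/
  filt_top : ∀ (n : ℕ) (p : ℤ), p ≤ 0 → filt n p = ⊤
  /-- the filtration is finite -/
  filt_bot : ∀ (n : ℕ) (p : ℤ), (n : ℤ) < p → filt n p = ⊥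
  /-- the graded pieces `F^p H^n / F^{p+1} H^n` of the abutment are the stable terms
  `E_∞^{p, n-p}` -/
  graded : ∀ (n : ℕ) (p : ℤ),
    Nonempty ((cokernel (Subobject.ofLE _ _ (filt_antitone n p))) ≅
      Einf p ((n : ℤ) - p))

namespace GSS

lemma graded_aux {C : Type*} [Category C] [Abelian C] {P' P H N E : C}
    (u : P' ⟶ P) (v : P ⟶ H) (w : H ⟶ N) (a : P ⟶ E) (b : E ⟶ N)
    [Epi a] [Mono b] (hab : v ≫ w = a ≫ b) (zero : (u ≫ v) ≫ w = 0)
    (hex : (ShortComplex.mk (u ≫ v) w zero).Exact)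
    (hle : imageSubobject (u ≫ v) ≤ imageSubobject v) :
    Nonempty (cokernel (Subobject.ofLE _ _ hle) ≅ E) := by
  let S := imageSubobject v
  let π := factorThruImageSubobject v
  have hπ : π ≫ S.arrow = v := imageSubobject_arrow_comp v
  have sq : CommSq a π b (S.arrow ≫ w) := ⟨by rw [← hab, reassoc_of% hπ]⟩
  have : Epi π := inferInstance
  have : StrongEpi π := strongEpi_of_epi π
  let c : (S : C) ⟶ E := sq.lift
  have hc1 : π ≫ c = a := sq.fac_left
  have hc2 : c ≫ b = S.arrow ≫ w := sq.fac_right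
  have : Epi (π ≫ c) := by rw [hc1]; infer_instance
  have : Epi c := epi_of_epi π c
  have hz : Subobject.ofLE _ _ hle ≫ c = 0 := by
    rw [← cancel_mono b, Category.assoc, hc2, Subobject.ofLE_arrow_assoc, zero_comp,
      ← cancel_epi (factorThruImageSubobject (u ≫ v)), imageSubobject_arrow_comp_assoc, zero,
      comp_zero]
  have hE : (ShortComplex.mk _ c hz).Exact := by
    rw [ShortComplex.exact_iff_exact_up_to_refinements]
    intro T x hx
    dsimp at x hx
    rw [ShortComplex.exact_iff_exact_up_to_refinements] at hex
    obtain ⟨T', t, _, y, hy⟩ := hex (x ≫ S.arrow) (by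
      dsimp
      rw [Category.assoc, ← hc2, reassoc_of% hx, zero_comp])
    refine ⟨T', t, inferInstance, y ≫ factorThruImageSubobject (u ≫ v), ?_⟩
    dsimp at hy y ⊢
    rw [← cancel_mono S.arrow]
    simp only [Category.assoc] at hy ⊢
    erw [Subobject.ofLE_arrow, imageSubobject_arrow_comp]
    exact hy
  exact ⟨IsColimit.coconePointUniqueUpToIso (cokernelIsCokernel _) hE.gIsCokernel⟩

lemma graded_aux' {C : Type*} [Category C] [Abelian C] {P' P H N E : C}
    (u : P' ⟶ P) (v : P ⟶ H) (x : P' ⟶ H) (hx : u ≫ v = x)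
    (w : H ⟶ N) (a : P ⟶ E) (b : E ⟶ N)
    [Epi a] [Mono b] (hab : v ≫ w = a ≫ b) (zero : x ≫ w = 0)
    (hex : (ShortComplex.mk x w zero).Exact)
    (hle : imageSubobject x ≤ imageSubobject v) :
    Nonempty (cokernel (Subobject.ofLE _ _ hle) ≅ E) := by
  subst hx
  exact graded_aux u v w a b hab zero hex hle

lemma imageSubobject_congr {C : Type*} [Category C] [Abelian C] {P H : C} {f g : P ⟶ H}
    (h : f = g) : imageSubobject f = imageSubobject g := by
  subst h; rfl

end GSS

namespace GSS

open Abelian ComposableArrows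

lemma sc_homology_iso {C κ : Type*} [Category C] [Abelian C] {c : ComplexShape κ}
    (K : HomologicalComplex C c) (i j j' k : κ) (hij : c.Rel i j') (hjk : c.Rel j k)
    (hj : j' = j) (h : K.X j' = K.X j) (w : (K.d i j' ≫ eqToHom h) ≫ K.d j k = 0) :
    Nonempty (K.homology j ≅ (ShortComplex.mk (K.d i j' ≫ eqToHom h) (K.d j k) w).homology) := by
  subst hj
  refine ⟨K.homologyIsoSc' i j' k (c.prev_eq' hij) (c.next_eq' hjk) ≪≫
    ShortComplex.homologyMapIso (S₁ := K.sc' i j' k)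
      (S₂ := ShortComplex.mk (K.d i j' ≫ eqToHom h) (K.d j' k) w)
      (ShortComplex.isoMk (Iso.refl (K.X i)) (Iso.refl (K.X j')) (Iso.refl (K.X k)) ?_ ?_)⟩
  · simp only [eqToHom_refl]
    exact Category.id_comp _
  · exact (Category.id_comp _).trans (Category.comp_id (K.d j' k)).symm

section

variable {C : Type*} [Category C] [Abelian C] (Y : Abelian.SpectralObject C EInt)

noncomputable abbrev thePage (r : ℕ) (hr : 2 ≤ r) (p q : ℤ) : C :=
  (Y.E₂SpectralSequence.page (r : ℤ) (by omega)).X (p, q)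

noncomputable def theD (r : ℕ) (hr : 2 ≤ r) (p q : ℤ) :
    thePage Y r hr p q ⟶ thePage Y r hr (p + r) (q - r + 1) :=
  (Y.E₂SpectralSequence.page (r : ℤ) (by omega)).d _ _

lemma theD_comp (r : ℕ) (hr : 2 ≤ r) (p q : ℤ) :
    theD Y r hr p q ≫ theD Y r hr (p + r) (q - r + 1) = 0 :=
  HomologicalComplex.d_comp_d _ _ _ _

lemma theNext (r : ℕ) (hr : 2 ≤ r) (hr' : 2 ≤ r + 1) (p q : ℤ)
    (h : thePage Y r hr (p - r + r) (q + r - 1 - r + 1) = thePage Y r hr p q)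
    (w : (theD Y r hr (p - r) (q + r - 1) ≫ eqToHom h) ≫ theD Y r hr p q = 0) :
    Nonempty (thePage Y (r + 1) hr' p q ≅
      (ShortComplex.mk (theD Y r hr (p - r) (q + r - 1) ≫ eqToHom h) (theD Y r hr p q)
        w).homology) := by
  obtain ⟨e⟩ := sc_homology_iso (Y.E₂SpectralSequence.page (r : ℤ) (by omega))
    (p - r, q + r - 1) (p, q) (p - r + r, q + r - 1 - r + 1) (p + r, q - r + 1)
    (by rw [ComplexShape.up'_Rel]; ext <;> simp; ring)
    (by rw [ComplexShape.up'_Rel]; ext <;> simp; ring)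
    (by ext <;> simp; ring) h w
  exact ⟨(Y.E₂SpectralSequence.iso (r : ℤ) ((r + 1 : ℕ) : ℤ) (p, q) (by simp) (by omega)).symm ≪≫ e⟩

lemma theVanish [Y.IsFirstQuadrant] (r : ℕ) (hr : 2 ≤ r) (p q : ℤ) (h : p < 0 ∨ q < 0) :
    IsZero (thePage Y r hr p q) := by
  rcases h with h | h
  · exact Y.isZero_spectralSequence_page_X_of_isZero_H' _ _ (by omega) _ 
      (Y.isZero₂_of_isFirstQuadrant _ _ _ _ (by simp; lia))
  · exact Y.isZero_spectralSequence_page_X_of_isZero_H' _ _ (by omega) _ 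
      (Y.isZero₁_of_isFirstQuadrant _ _ _ (by simp; lia) _)

abbrev co (n : ℤ) : EInt := WithBotTop.coe n

lemma co_mono {a b : ℤ} (h : a ≤ b) : co a ≤ co b := by
  simpa using h

noncomputable abbrev theEinf (p q : ℤ) : C :=
  Y.E (homOfLE (bot_le : ⊥ ≤ co q)) (homOfLE (co_mono (by omega : q ≤ q + 1)))
    (homOfLE (le_top : co (q + 1) ≤ ⊤)) (p + q - 1) (p + q) (p + q + 1)

lemma theStab [Y.IsFirstQuadrant] (p q : ℤ) (r : ℕ) (hr : 2 ≤ r) (h1 : q + 2 ≤ r) (h2 : p < r) :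
    Nonempty (thePage Y r hr p q ≅ theEinf Y p q) := by
  refine ⟨Y.spectralSequencePageXIso SpectralObject.coreE₂Cohomological (r : ℤ) (by omega) (p, q) (co (q - r + 2)) (co q)
    (co (q + 1)) (co (q + r - 1)) rfl rfl rfl rfl (p + q - 1) (p + q) (p + q + 1) rfl ≪≫ ?_⟩
  refine (Y.isoMapFourδ₁Toδ₀' ⊥ _ _ _ _ bot_le _ _ _ _ _ _ ?_).symm ≪≫
    Y.isoMapFourδ₄Toδ₃' _ _ _ _ ⊤ _ _ _ le_top _ _ _ ?_
  · exact Y.isZero₁_of_isFirstQuadrant _ _ _ (co_mono (by omega)) _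
  · exact Y.isZero₂_of_isFirstQuadrant _ _ _ _ (by simp [co]; omega)

end

end GSS

namespace GSS

open Abelian ComposableArrows

section

variable {C : Type*} [Category C] [Abelian C] (Y : Abelian.SpectralObject C EInt)

noncomputable def filtMap (n : ℤ) (j : ℤ) :
    (Y.H n).obj (mk₁ (homOfLE (bot_le : ⊥ ≤ co j))) ⟶
      (Y.H n).obj (mk₁ (homOfLE (bot_le : (⊥ : EInt) ≤ ⊤))) :=
  (Y.H n).map (twoδ₂Toδ₁ _ (homOfLE (le_top : co j ≤ ⊤)) _ (Subsingleton.elim _ _))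

noncomputable def filtj (n : ℤ) {Hn : C}
    (e : (Y.H n).obj (mk₁ (homOfLE (bot_le : (⊥ : EInt) ≤ ⊤))) ≅ Hn) (j : ℤ) :
    Subobject Hn := imageSubobject (filtMap Y n j ≫ e.hom)

noncomputable def filtStep (n : ℤ) (i j : ℤ) (h : i ≤ j) :
    (Y.H n).obj (mk₁ (homOfLE (bot_le : ⊥ ≤ co i))) ⟶
    (Y.H n).obj (mk₁ (homOfLE (bot_le : ⊥ ≤ co j))) :=
  (Y.H n).map (twoδ₂Toδ₁ _ (homOfLE (co_mono h)) _ (Subsingleton.elim _ _))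

lemma hom_eq {X Z : ComposableArrows EInt 1} (f g : X ⟶ Z) : f = g := by
  ext <;> exact Subsingleton.elim _ _

lemma filtStep_comp (n : ℤ) (i j : ℤ) (h : i ≤ j) :
    filtStep Y n i j h ≫ filtMap Y n j = filtMap Y n i := by
  rw [filtStep, filtMap, filtMap, ← Functor.map_comp]
  exact congrArg _ (hom_eq _ _)

lemma filtj_mono (n : ℤ) {Hn : C}
    (e : (Y.H n).obj (mk₁ (homOfLE (bot_le : (⊥ : EInt) ≤ ⊤))) ≅ Hn) (i j : ℤ) (h : i ≤ j) :
    filtj Y n e i ≤ filtj Y n e j := by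
  have h1 : filtMap Y n i ≫ e.hom = filtStep Y n i j h ≫ filtMap Y n j ≫ e.hom := by
    rw [← filtStep_comp Y n i j h, Category.assoc]
  refine (imageSubobject_congr h1).trans_le ?_
  exact imageSubobject_comp_le _ _

lemma filtj_bot [Y.IsFirstQuadrant] (n : ℤ) {Hn : C}
    (e : (Y.H n).obj (mk₁ (homOfLE (bot_le : (⊥ : EInt) ≤ ⊤))) ≅ Hn) (j : ℤ) (hj : j ≤ 0) :
    filtj Y n e j = ⊥ := by
  have : filtMap Y n j = 0 :=
    (Y.isZero₁_of_isFirstQuadrant _ _ _ (co_mono hj) _).eq_of_src _ _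
  exact (imageSubobject_congr (by rw [this, zero_comp])).trans imageSubobject_zero

lemma filtj_top [Y.IsFirstQuadrant] (n : ℤ) {Hn : C}
    (e : (Y.H n).obj (mk₁ (homOfLE (bot_le : (⊥ : EInt) ≤ ⊤))) ≅ Hn) (j : ℤ) (hj : n < j) :
    filtj Y n e j = ⊤ := by
  have : Epi (filtMap Y n j) := by
    refine (Y.exact₂ (homOfLE (bot_le : ⊥ ≤ co j)) (homOfLE (le_top : co j ≤ ⊤))
      (homOfLE (bot_le : (⊥ : EInt) ≤ ⊤)) (Subsingleton.elim _ _) n).epi_f ?_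
    exact (Y.isZero₂_of_isFirstQuadrant _ _ _ _ (by simp [co]; omega)).eq_of_tgt _ _
  have : Epi (filtMap Y n j ≫ e.hom) := inferInstance
  have h2 : Epi (imageSubobject (filtMap Y n j ≫ e.hom)).arrow := by
    have h3 := imageSubobject_arrow_comp (filtMap Y n j ≫ e.hom)
    rw [← h3] at this
    exact epi_of_epi (factorThruImageSubobject (filtMap Y n j ≫ e.hom)) _
  have : IsIso (imageSubobject (filtMap Y n j ≫ e.hom)).arrow := isIso_of_mono_of_epi _
  rw [filtj]
  exact Subobject.eq_top_of_isIso_arrow _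

lemma filtj_graded (n p q : ℤ) (hn : p + q = n) {Hn : C}
    (e : (Y.H n).obj (mk₁ (homOfLE (bot_le : (⊥ : EInt) ≤ ⊤))) ≅ Hn)
    (j' j : ℤ) (hj' : j' = q) (hj : j = q + 1) (hle : filtj Y n e j' ≤ filtj Y n e j) :
    Nonempty (cokernel (Subobject.ofLE _ _ hle) ≅ theEinf Y p q) := by
  subst hj' hj hn
  have hq : j' ≤ j' + 1 := by omega
  let w : (Y.H (p + j')).obj (mk₁ (homOfLE (bot_le : (⊥ : EInt) ≤ ⊤))) ⟶
      (Y.H (p + j')).obj (mk₁ (homOfLE (le_top : co j' ≤ ⊤))) :=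
    (Y.H (p + j')).map (twoδ₁Toδ₀ (homOfLE (bot_le : ⊥ ≤ co j')) _ _ (Subsingleton.elim _ _))
  let a : (Y.H (p + j')).obj (mk₁ (homOfLE (bot_le : ⊥ ≤ co (j' + 1)))) ⟶ theEinf Y p j' :=
    Y.toCycles (homOfLE (bot_le : ⊥ ≤ co j')) (homOfLE (co_mono hq)) _ (Subsingleton.elim _ _) _ ≫
      Y.πE _ _ _ _ _ _
  let b : theEinf Y p j' ⟶ (Y.H (p + j')).obj (mk₁ (homOfLE (le_top : co j' ≤ ⊤))) :=
    Y.ιE _ _ _ _ _ _ ≫ Y.fromOpcycles (homOfLE (co_mono hq))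
      (homOfLE (le_top : co (j' + 1) ≤ ⊤)) _ (Subsingleton.elim _ _) _
  have hab : filtMap Y (p + j') (j' + 1) ≫ w = a ≫ b := by
    dsimp only [a, b, theEinf]
    rw [Category.assoc, Y.πE_ιE_assoc _ _ _ (p + j' - 1) (p + j') (p + j' + 1), SpectralObject.toCycles_i_assoc,
      SpectralObject.p_fromOpcycles, filtMap, ← Functor.map_comp, ← Functor.map_comp]
    exact congrArg _ (hom_eq _ _)
  have ha : Epi a := by dsimp only [a]; exact epi_comp _ _
  have hb : Mono b := by dsimp only [b]; exact mono_comp _ _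
  have hz : filtMap Y (p + j') j' ≫ w = 0 :=
    (Y.sc₂ (homOfLE (bot_le : ⊥ ≤ co j')) (homOfLE (le_top : co j' ≤ ⊤))
      (homOfLE (bot_le : (⊥ : EInt) ≤ ⊤)) (Subsingleton.elim _ _) (p + j')).zero
  have hex : (ShortComplex.mk (filtMap Y (p + j') j') w hz).Exact :=
    Y.exact₂ (homOfLE (bot_le : ⊥ ≤ co j')) (homOfLE (le_top : co j' ≤ ⊤))
      (homOfLE (bot_le : (⊥ : EInt) ≤ ⊤)) (Subsingleton.elim _ _) (p + j')
  have key : filtStep Y (p + j') j' (j' + 1) hq ≫ filtMap Y (p + j') (j' + 1) ≫ e.hom =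
      filtMap Y (p + j') j' ≫ e.hom := by
    rw [← filtStep_comp Y _ _ _ hq, Category.assoc]
  have hz' : (filtMap Y (p + j') j' ≫ e.hom) ≫ e.inv ≫ w = 0 := by
    simp [hz]
  have hex' : (ShortComplex.mk (filtMap Y (p + j') j' ≫ e.hom) (e.inv ≫ w) hz').Exact := by
    refine ShortComplex.exact_of_iso (S₁ := ShortComplex.mk (filtMap Y (p + j') j') w hz)
      (S₂ := ShortComplex.mk (filtMap Y (p + j') j' ≫ e.hom) (e.inv ≫ w) hz')
      (ShortComplex.isoMk (Iso.refl _) e (Iso.refl _) ?_ ?_) hex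
    · exact Category.id_comp _
    · exact (e.hom_inv_id_assoc w).trans (Category.comp_id w).symm
  exact graded_aux' (filtStep Y (p + j') j' (j' + 1) hq)
    (filtMap Y (p + j') (j' + 1) ≫ e.hom) _ key (e.inv ≫ w) a b (by simp [hab]) hz' hex' hle

theorem spectral_of_object [Y.IsFirstQuadrant] (E₂ : ℕ → ℕ → C) (H : ℕ → C)
    (h2 : ∀ p q : ℕ, Nonempty ((Y.H (p + q)).obj
      (mk₁ (homOfLE (co_mono (by omega : (q : ℤ) ≤ q + 1)))) ≅ E₂ p q))
    (hH : ∀ n : ℕ, Nonempty ((Y.H n).obj (mk₁ (homOfLE (bot_le : (⊥ : EInt) ≤ ⊤))) ≅ H n)) :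
    Nonempty (ConvergentFirstQuadrantSpectralSequence E₂ H) := by
  let e := fun n => (hH n).some
  refine ⟨{
    page := thePage Y
    pageTwo := fun p q => Y.spectralSequenceFirstPageXIso SpectralObject.coreE₂Cohomological
      (p, q) (co q) (co (q + 1)) rfl rfl (p + q) rfl ≪≫ (h2 p q).some
    vanish := theVanish Y
    d := theD Y
    d_comp_d := theD_comp Y
    nextPage := fun r hr hr' p q h w => (theNext Y r hr hr' p q h w).some
    Einf := theEinf Y
    stab := fun p q => ⟨p.natAbs + q.natAbs + 2, by omega, fun r hr hr' =>
      theStab Y p q r hr (by omega) (by omega)⟩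
    filt := fun n p => filtj Y n (e n) (n - p + 1)
    filt_antitone := fun n p => filtj_mono _ _ _ _ _ (by omega)
    filt_top := fun n p hp => filtj_top _ _ _ _ (by omega)
    filt_bot := fun n p hp => filtj_bot _ _ _ _ (by omega)
    graded := fun n p => filtj_graded Y n p (n - p) (by omega) _ _ _ (by omega) (by omega) _ }⟩

end

end GSS

namespace GSS

open Abelian ComposableArrows Pretriangulated

section

variable {T A ι : Type*} [Category T] [Category A] [Category ι] [HasZeroObject T]
  [HasShift T ℤ] [Preadditive T] [∀ (n : ℤ), (shiftFunctor T n).Additive] [Pretriangulated T]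
  [Abelian A] (F : T ⥤ A) [F.IsHomological] [F.ShiftSequence ℤ]

noncomputable def homObj (X : Triangulated.SpectralObject T ι) :
    Abelian.SpectralObject A ι where
  H n := X.ω₁ ⋙ F.shift n
  δ' n₀ n₁ h :=
    { app := fun D => F.homologySequenceδ (X.ω₂.obj D) n₀ n₁ h
      naturality := fun D D' φ =>
        F.homologySequenceδ_naturality (X.ω₂.obj D) (X.ω₂.obj D') (X.ω₂.map φ) n₀ n₁ h }
  exact₁' n₀ n₁ h D :=
    (F.homologySequence_exact₁ _ (X.ω₂_obj_distinguished D) n₀ n₁ h).exact_toComposableArrows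
  exact₂' n D :=
    (F.homologySequence_exact₂ _ (X.ω₂_obj_distinguished D) n).exact_toComposableArrows
  exact₃' n₀ n₁ h D :=
    (F.homologySequence_exact₃ _ (X.ω₂_obj_distinguished D) n₀ n₁ h).exact_toComposableArrows

end

end GSS

namespace GSS

section
variable {B C : Type*} [Category B] [Abelian B] [Category C] [Abelian C]
  [HasDerivedCategory B] (G : B ⥤ C) [G.Additive]

variable (B) in
noncomputable abbrev Phi : HomotopyCategory.Plus (InjectiveObject B) ⥤ DerivedCategory.Plus B :=
  (InjectiveObject.ι B).mapHomotopyCategoryPlus ⋙ DerivedCategory.Plus.Qh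

noncomputable abbrev Psi :
    HomotopyCategory.Plus (InjectiveObject B) ⥤ HomotopyCategory C (.up ℤ) :=
  (InjectiveObject.ι B ⋙ G).mapHomotopyCategoryPlus ⋙ HomotopyCategory.Plus.ι C

lemma isKInj (L : HomotopyCategory.Plus (InjectiveObject B)) :
    CochainComplex.IsKInjective ((InjectiveObject.ι B).mapHomotopyCategoryPlus.obj L).obj.as := by
  obtain ⟨L, hL⟩ := L
  obtain ⟨K : CochainComplex _ _, rfl⟩ := HomotopyCategory.quotient_obj_surjective L
  rw [HomotopyCategory.plus_quotient_obj_iff] at hL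
  obtain ⟨n, hn⟩ := hL
  let L : CochainComplex B ℤ := ((InjectiveObject.ι B).mapHomologicalComplex (.up ℤ)).obj K
  have (n : ℤ) : Injective (L.X n) := (K.X n).property
  have : L.IsStrictlyGE n := inferInstance
  have : L.IsKInjective := CochainComplex.isKInjective_of_injective L n
  exact this

lemma Phi_map_bij (K L : HomotopyCategory.Plus (InjectiveObject B)) :
    Function.Bijective ((Phi B).map : (K ⟶ L) → _) := by
  have h1 := DerivedCategory.Plus.Qh_map_bijective_of_isKInjective
    ((InjectiveObject.ι B).mapHomotopyCategoryPlus.obj K)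
    ((InjectiveObject.ι B).mapHomotopyCategoryPlus.obj L) (isKInj L)
  have h2 : Function.Bijective
    ((InjectiveObject.ι B).mapHomotopyCategoryPlus.map : (K ⟶ L) → _) :=
    ⟨Functor.map_injective _, Functor.map_surjective _⟩
  exact h1.comp h2

instance : (Phi B).Faithful := ⟨fun {_ _ _ _} h => (Phi_map_bij _ _).1 h⟩
instance : (Phi B).Full := ⟨(Phi_map_bij _ _).2⟩
instance [EnoughInjectives B] : (Phi B).IsEquivalence where

theorem exists_RG [EnoughInjectives B] :
    ∃ (T : DerivedCategory.Plus B ⥤ HomotopyCategory C (.up ℤ)) (_ : T.CommShift ℤ)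
      (_ : T.IsTriangulated), Nonempty (Phi B ⋙ T ≅ Psi G) := by
  let adj := (Phi B).asEquivalence.toAdjunction
  let c1 : (Phi B).CommShift ℤ := inferInstance
  let : (Phi B).asEquivalence.functor.CommShift ℤ := c1
  let : (Phi B).asEquivalence.inverse.CommShift ℤ := adj.rightAdjointCommShift ℤ
  have : adj.CommShift ℤ := adj.commShift_of_leftAdjoint ℤ
  have : (Phi B).asEquivalence.functor.IsTriangulated := inferInstanceAs ((Phi B).IsTriangulated)
  have : (Phi B).asEquivalence.inverse.IsTriangulated := adj.isTriangulated_rightAdjoint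
  refine ⟨(Phi B).asEquivalence.inverse ⋙ Psi G, inferInstance, inferInstance,
    ⟨(Functor.associator _ _ _).symm ≪≫
      Functor.isoWhiskerRight (Phi B).asEquivalence.unitIso.symm (Psi G) ≪≫ Functor.leftUnitor _⟩⟩

end

end GSS

namespace GSS

section
variable {B C : Type*} [Category B] [Abelian B] [Category C] [Abelian C]
  [HasDerivedCategory B] (G : B ⥤ C) [G.Additive]
  (T : DerivedCategory.Plus B ⥤ HomotopyCategory C (.up ℤ))
  (hT : Nonempty (Phi B ⋙ T ≅ Psi G))

include hT

lemma T_homology (M : CochainComplex B ℤ) (a : ℤ) [M.IsStrictlyGE a]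
    (hM : ∀ i, Injective (M.X i)) (X : DerivedCategory.Plus B)
    (e : DerivedCategory.Q.obj M ≅ X.obj) :
    Nonempty (T.obj X ≅ (HomotopyCategory.quotient C (.up ℤ)).obj
      ((G.mapHomologicalComplex (.up ℤ)).obj M)) := by
  obtain ⟨α⟩ := hT
  let L' : CochainComplex (InjectiveObject B) ℤ :=
    HomologicalComplex.liftObjectProperty _ M hM
  have hL' : L'.IsStrictlyGE a := by
    rw [← CochainComplex.isStrictlyGE_mapHomologicalComplex_obj_iff _ (InjectiveObject.ι B)]
    exact (inferInstance : M.IsStrictlyGE a)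
  let L : HomotopyCategory.Plus (InjectiveObject B) :=
    (HomotopyCategory.Plus.quotient _).obj ⟨L', a, hL'⟩
  have e1 : DerivedCategory.Q.obj M ≅ ((Phi B).obj L).obj :=
    ((DerivedCategory.quotientCompQhIso B).symm.app M)
  let e2 : (Phi B).obj L ≅ X := DerivedCategory.Plus.ι.preimageIso (e1.symm ≪≫ e)
  exact ⟨T.mapIso e2.symm ≪≫ α.app L⟩

lemma T_homology' (M : CochainComplex B ℤ) (a : ℤ) [M.IsStrictlyGE a]
    (hM : ∀ i, Injective (M.X i)) (X : DerivedCategory.Plus B)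
    (e : DerivedCategory.Q.obj M ≅ X.obj) (n : ℤ) :
    Nonempty ((HomotopyCategory.homologyFunctor C (.up ℤ) n).obj (T.obj X) ≅
      ((G.mapHomologicalComplex (.up ℤ)).obj M).homology n) := by
  obtain ⟨f⟩ := T_homology G T hT M a hM X e
  exact ⟨(HomotopyCategory.homologyFunctor C (.up ℤ) n).mapIso f ≪≫
    (HomotopyCategory.homologyFunctorFactors C (.up ℤ) n).app _⟩

lemma T_vanish [EnoughInjectives B] (X : DerivedCategory.Plus B) (a : ℤ) [X.IsGE a]
    (n : ℤ) (hn : n < a) :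
    IsZero ((HomotopyCategory.homologyFunctor C (.up ℤ) n).obj (T.obj X)) := by
  obtain ⟨L, hL, ⟨e⟩⟩ := DerivedCategory.Plus.exists_injective_nonempty_iso X a
  let M : CochainComplex B ℤ := ((InjectiveObject.ι B).mapHomologicalComplex (.up ℤ)).obj L.obj
  have : M.IsStrictlyGE a := inferInstance
  obtain ⟨f⟩ := T_homology' G T hT M a (fun i => (L.obj.X i).property) X
    (DerivedCategory.Plus.ι.mapIso e) n
  refine IsZero.of_iso ?_ f
  have : ((G.mapHomologicalComplex (.up ℤ)).obj M).ExactAt n := by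
    apply ShortComplex.exact_of_isZero_X₂
    exact G.map_isZero (M.isZero_of_isStrictlyGE a n hn)
  exact this.isZero_homology

end

end GSS

namespace GSS

section
variable {B C : Type*} [Category B] [Abelian B] [Category C] [Abelian C]
  (G : B ⥤ C) [G.Additive]

omit [G.Additive] in
lemma mapExtend_aux {X X' Y Y' : B} {Z Z' : C} (e : X ≅ X') (e' : Y ≅ Y') (f : X' ⟶ Y')
    (a : Z ≅ G.obj X') (a' : Z' ≅ G.obj Y') :
    (G.mapIso e ≪≫ a.symm).hom ≫ (a.hom ≫ G.map f ≫ a'.inv) =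
      G.map (e.hom ≫ f ≫ e'.inv) ≫ (G.mapIso e' ≪≫ a'.symm).hom := by
  simp only [Iso.trans_hom, Functor.mapIso_hom, Iso.symm_hom, Category.assoc, Iso.inv_hom_id_assoc,
    Functor.map_comp]
  rw [← G.map_comp_assoc e'.inv]
  simp

lemma mapExtend_comm (K : CochainComplex B ℕ) (i j : ℕ) (i' j' : ℤ)
    (hi : ComplexShape.embeddingUpNat.f i = i') (hj : ComplexShape.embeddingUpNat.f j = j') :
    (G.mapIso (K.extendXIso ComplexShape.embeddingUpNat hi) ≪≫
      (HomologicalComplex.extendXIso ((G.mapHomologicalComplex (.up ℕ)).obj K)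
        ComplexShape.embeddingUpNat hi).symm).hom ≫
      (((G.mapHomologicalComplex (.up ℕ)).obj K).extend ComplexShape.embeddingUpNat).d i' j' =
    G.map ((K.extend ComplexShape.embeddingUpNat).d i' j') ≫
    (G.mapIso (K.extendXIso ComplexShape.embeddingUpNat hj) ≪≫
      (HomologicalComplex.extendXIso ((G.mapHomologicalComplex (.up ℕ)).obj K)
        ComplexShape.embeddingUpNat hj).symm).hom := by
  rw [HomologicalComplex.extend_d_eq _ ComplexShape.embeddingUpNat hi hj,
    HomologicalComplex.extend_d_eq _ ComplexShape.embeddingUpNat hi hj]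
  exact mapExtend_aux G _ _ _ _ _

noncomputable def mapExtendX (K : CochainComplex B ℕ) : ∀ (i : ℤ),
    ((G.mapHomologicalComplex (.up ℤ)).obj (K.extend ComplexShape.embeddingUpNat)).X i ≅
      (((G.mapHomologicalComplex (.up ℕ)).obj K).extend ComplexShape.embeddingUpNat).X i
  | Int.ofNat k => G.mapIso (K.extendXIso ComplexShape.embeddingUpNat (i := k)
        (i' := Int.ofNat k) rfl) ≪≫
      (HomologicalComplex.extendXIso ((G.mapHomologicalComplex (.up ℕ)).obj K)
        ComplexShape.embeddingUpNat (i := k) (i' := Int.ofNat k) rfl).symm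
  | Int.negSucc k => IsZero.iso
      (G.map_isZero (K.isZero_extend_X _ _ (by intro i; simp)))
      (HomologicalComplex.isZero_extend_X _ _ _ (by intro i; simp))

noncomputable def mapExtend (K : CochainComplex B ℕ) :
    (G.mapHomologicalComplex (.up ℤ)).obj (K.extend ComplexShape.embeddingUpNat) ≅
      ((G.mapHomologicalComplex (.up ℕ)).obj K).extend ComplexShape.embeddingUpNat :=
  HomologicalComplex.Hom.isoOfComponents (mapExtendX G K) (by
    rintro (i | i) j hij
    · obtain rfl : Int.ofNat (i + 1) = j := hij
      exact mapExtend_comm G K i (i + 1) _ _ rfl rfl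
    · exact (G.map_isZero (K.isZero_extend_X _ _ (by intro i; simp))).eq_of_src _ _)

noncomputable def mapExtendHomology (K : CochainComplex B ℕ) (p : ℕ) :
    ((G.mapHomologicalComplex (.up ℤ)).obj
      (K.extend ComplexShape.embeddingUpNat)).homology (p : ℤ) ≅
      ((G.mapHomologicalComplex (.up ℕ)).obj K).homology p :=
  HomologicalComplex.homologyMapIso (mapExtend G K) (p : ℤ) ≪≫
    HomologicalComplex.extendHomologyIso _ _ rfl

noncomputable def derivedIso [HasInjectiveResolutions B] {X : B} (I : InjectiveResolution X) (p : ℕ) :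
    ((G.mapHomologicalComplex (.up ℤ)).obj I.cochainComplex).homology (p : ℤ) ≅
      (G.rightDerived p).obj X :=
  mapExtendHomology G I.cocomplex p ≪≫ (I.isoRightDerivedObj G p).symm

noncomputable def shiftHomologyIso (K : CochainComplex B ℤ) (s a a' : ℤ) (h : s + a = a') :
   ((G.mapHomologicalComplex (.up ℤ)).obj (K⟦s⟧)).homology a ≅
   ((G.mapHomologicalComplex (.up ℤ)).obj K).homology a' :=
  HomologicalComplex.homologyMapIso
    (((G.mapHomologicalComplex (.up ℤ)).commShiftIso s).app K) a ≪≫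
    (CochainComplex.ShiftSequence.shiftIso C s a a' h).app _

end

section
variable {B C : Type*} [Category B] [Abelian B] [Category C] [Abelian C]
  [HasDerivedCategory B] (G : B ⥤ C) [G.Additive] [EnoughInjectives B]
  (T : DerivedCategory.Plus B ⥤ HomotopyCategory C (.up ℤ))
  (hT : Nonempty (Phi B ⋙ T ≅ Psi G))

lemma single_iso {M : B} (I : InjectiveResolution M) (q : ℤ) :
    Nonempty (DerivedCategory.Q.obj (I.cochainComplex⟦-q⟧) ≅ 
      (DerivedCategory.singleFunctor B q).obj M) := by
  have e0 : DerivedCategory.Q.obj I.cochainComplex ≅ (DerivedCategory.singleFunctor B 0).obj M :=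
    (asIso (DerivedCategory.Q.map I.ι')).symm
  have e1 := (((DerivedCategory.singleFunctors B).shiftIso (-q) q 0 (by simp)).app M).symm
  exact ⟨(DerivedCategory.Q.commShiftIso (-q)).app _ ≪≫ (shiftFunctor _ (-q)).mapIso e0 ≪≫ e1.symm⟩

include hT in
lemma T_single (X : DerivedCategory.Plus B) (M : B) (q : ℤ)
    (e : X.obj ≅ (DerivedCategory.singleFunctor B q).obj M) (p : ℕ) (n : ℤ) (hn : n = p + q) :
    Nonempty ((HomotopyCategory.homologyFunctor C (.up ℤ) n).obj (T.obj X) ≅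
      (G.rightDerived p).obj M) := by
  let I := injectiveResolution M
  obtain ⟨e'⟩ := single_iso I q
  have : CochainComplex.IsStrictlyGE (I.cochainComplex⟦-q⟧) q :=
    CochainComplex.isStrictlyGE_shift _ 0 (-q) q (by simp)
  obtain ⟨f⟩ := T_homology' G T hT (I.cochainComplex⟦-q⟧) q
    (fun i => inferInstanceAs (Injective (I.cochainComplex.X (i + -q)))) X (e' ≪≫ e.symm) n
  exact ⟨f ≪≫ shiftHomologyIso G _ (-q) n p (by omega) ≪≫ derivedIso G I p⟩

end

end GSS

namespace GSS

section
variable {B C : Type*} [Category B] [Abelian B] [Category C] [Abelian C]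
  (G : B ⥤ C) [G.Additive] [PreservesFiniteLimits G]

lemma pb_exact (S : ShortComplex B) (hS : S.ShortExact) {I0 I1 : B} (φ : S.X₂ ⟶ I0)
    (d : I0 ⟶ I1) (ψ : S.X₃ ⟶ I1) (h : S.g ≫ ψ = φ ≫ d)
    (hd : (ShortComplex.mk (S.f ≫ φ) d (by
      rw [Category.assoc, ← h, S.zero_assoc, zero_comp])).Exact) :
    (ShortComplex.mk (biprod.lift S.g φ) (biprod.desc ψ (-d)) (by simp [h])).Exact := by
  have := hS.epi_g
  rw [ShortComplex.exact_iff_exact_up_to_refinements] at hd ⊢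
  dsimp at hd ⊢
  intro A x hx
  obtain ⟨A', π, hπ, y, hy⟩ := surjective_up_to_refinements_of_epi S.g (x ≫ biprod.fst)
  have hx' : x ≫ biprod.fst ≫ ψ = x ≫ biprod.snd ≫ d := by
    rw [← sub_eq_zero]
    rw [← hx, ← Preadditive.comp_sub]
    congr 1
    ext <;> simp
  obtain ⟨A₂, π₂, hπ₂, w, hw⟩ := hd (π ≫ x ≫ biprod.snd - y ≫ φ) (by
    have e1 : π ≫ x ≫ biprod.snd ≫ d = y ≫ φ ≫ d := by
      rw [← hx', reassoc_of% hy]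
      exact congrArg (fun t => y ≫ t) h
    simp [e1])
  refine ⟨A₂, π₂ ≫ π, inferInstance, w ≫ S.f + π₂ ≫ y, ?_⟩
  ext
  · simp [hy]
  · simp only [Category.assoc, biprod.lift_snd, Preadditive.add_comp]
    rw [← hw]
    simp

lemma epi_of_acyclic [EnoughInjectives B] (S : ShortComplex B) (hS : S.ShortExact)
    (h1 : IsZero ((G.rightDerived 1).obj S.X₁)) : Epi (G.map S.g) := by
  have := hS.mono_f
  have := hS.epi_g
  let I := injectiveResolution S.X₁
  have h1' : (((G.mapHomologicalComplex (.up ℕ)).obj I.cocomplex).sc' 0 1 2).Exact := by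
    rw [← HomologicalComplex.exactAt_iff' _ 0 1 2 (by simp) (by simp),
      HomologicalComplex.exactAt_iff_isZero_homology]
    exact h1.of_iso (I.isoRightDerivedObj G 1).symm
  rw [ShortComplex.exact_iff_exact_up_to_refinements] at h1'
  let ι₀ : S.X₁ ⟶ I.cocomplex.X 0 := I.ι.f 0
  let d : I.cocomplex.X 0 ⟶ I.cocomplex.X 1 := I.cocomplex.d 0 1
  let φ : S.X₂ ⟶ I.cocomplex.X 0 := Injective.factorThru ι₀ S.f
  have hφ : S.f ≫ φ = ι₀ := Injective.comp_factorThru _ _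
  have hιd : ι₀ ≫ d = 0 := I.ι_f_zero_comp_complex_d
  let ψ : S.X₃ ⟶ I.cocomplex.X 1 := hS.exact.desc (φ ≫ d) (by
    rw [reassoc_of% hφ, hιd])
  have hψ : S.g ≫ ψ = φ ≫ d := hS.exact.g_desc _ _
  have hex : (ShortComplex.mk ι₀ d hιd).Exact := I.exact₀
  have hpb := pb_exact S hS φ d ψ hψ (by
    simp only [hφ]; exact hex)
  have hmono : Mono (biprod.lift S.g φ) := by
    rw [Preadditive.mono_iff_cancel_zero]
    intro A x hx
    have h2 : x ≫ S.g = 0 := by simpa using hx =≫ biprod.fst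
    have h3 : x ≫ φ = 0 := by simpa using hx =≫ biprod.snd
    obtain ⟨k, hk⟩ := hS.exact.lift' x h2
    have hk' : k ≫ ι₀ = 0 := by rw [← hφ, reassoc_of% hk, h3]
    have : Mono ι₀ := inferInstanceAs (Mono (I.ι.f 0))
    rw [← hk, zero_of_comp_mono ι₀ hk', zero_comp]
  have hpbG := hpb.map_of_mono_of_preservesKernel G hmono inferInstance
  rw [ShortComplex.exact_iff_exact_up_to_refinements] at hpbG
  have hA : ∀ ⦃A : C⦄ (x : A ⟶ G.obj (I.cocomplex.X 1)), x ≫ G.map (I.cocomplex.d 1 2) = 0 →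
      ∃ (A' : C) (π : A' ⟶ A) (_ : Epi π) (y : A' ⟶ G.obj (I.cocomplex.X 0)),
        π ≫ x = y ≫ G.map d := h1'
  have hB : ∀ ⦃A : C⦄ (x : A ⟶ G.obj (S.X₃ ⊞ I.cocomplex.X 0)),
      x ≫ G.map (biprod.desc ψ (-d)) = 0 →
      ∃ (A' : C) (π : A' ⟶ A) (_ : Epi π) (y : A' ⟶ G.obj S.X₂),
        π ≫ x = y ≫ G.map (biprod.lift S.g φ) := hpbG
  clear h1' hpbG
  rw [epi_iff_surjective_up_to_refinements]
  intro A z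
  obtain ⟨A₁, π₁, _, y0, hy0⟩ := hA (z ≫ G.map ψ) (by
    rw [Category.assoc, ← G.map_comp]
    have : ψ ≫ I.cocomplex.d 1 2 = 0 := by
      rw [← cancel_epi S.g, reassoc_of% hψ]
      simp [d]
    rw [this, G.map_zero, comp_zero])
  obtain ⟨A₂, π₂, _, y, hy⟩ := hB (π₁ ≫ z ≫ G.map biprod.inl + y0 ≫ G.map biprod.inr) (by
    simp only [Preadditive.add_comp, Category.assoc, ← G.map_comp, biprod.inl_desc, 
      biprod.inr_desc, G.map_neg, Preadditive.comp_neg]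
    rw [hy0]
    simp)
  refine ⟨A₂, π₂ ≫ π₁, inferInstance, y, ?_⟩
  have := hy =≫ G.map biprod.fst
  simpa [← G.map_comp, -Functor.map_comp] using this

end

end GSS

namespace GSS

open Pretriangulated

section
variable {B C : Type*} [Category B] [Abelian B] [Category C] [Abelian C]
  [HasDerivedCategory B] (G : B ⥤ C) [G.Additive] [EnoughInjectives B]
  (T : DerivedCategory.Plus B ⥤ HomotopyCategory C (.up ℤ))
  [T.CommShift ℤ] [T.IsTriangulated]
  (hT : Nonempty (Phi B ⋙ T ≅ Psi G))

include hT in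
lemma acyclic_of_ses (S : ShortComplex B) (hS : S.ShortExact)
    (h1 : ∀ p : ℕ, 0 < p → IsZero ((G.rightDerived p).obj S.X₁))
    (h2 : ∀ p : ℕ, 0 < p → IsZero ((G.rightDerived p).obj S.X₂))
    (p : ℕ) (hp : 0 < p) : IsZero ((G.rightDerived p).obj S.X₃) := by
  obtain ⟨W, g, h, mem⟩ := distinguished_cocone_triangle
    ((DerivedCategory.Plus.singleFunctor B 0).map S.f)
  have mem' := DerivedCategory.Plus.ι.map_distinguished _ mem
  have e : W.obj ≅ (DerivedCategory.singleFunctor B 0).obj S.X₃ :=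
    Triangle.π₃.mapIso (isoTriangleOfIso₁₂ _ _ mem' hS.singleTriangle_distinguished
      (Iso.refl _) (Iso.refl _) 
      ((Category.comp_id _).trans (Category.id_comp _).symm))
  obtain ⟨e3⟩ := T_single G T hT W S.X₃ 0 e p p (by simp)
  refine IsZero.of_iso ?_ e3.symm
  let H := HomotopyCategory.homologyFunctor C (.up ℤ) 0
  have ex := H.homologySequence_exact₃ _ (T.map_distinguished _ mem) (p : ℤ) (p + 1) rfl
  refine ex.isZero_of_both_zeros (IsZero.eq_of_src ?_ _ _) (IsZero.eq_of_tgt ?_ _ _)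
  · obtain ⟨e2⟩ := T_single G T hT ((DerivedCategory.Plus.singleFunctor B 0).obj S.X₂) S.X₂ 0
      (Iso.refl _) p p (by simp)
    exact (h2 p hp).of_iso e2
  · obtain ⟨e1⟩ := T_single G T hT ((DerivedCategory.Plus.singleFunctor B 0).obj S.X₁) S.X₁ 0
      (Iso.refl _) (p + 1) (p + 1 : ℤ) (by simp)
    exact (h1 (p + 1) (by omega)).of_iso e1

variable [PreservesFiniteLimits G]

lemma cycles_ses (K : CochainComplex B ℤ) (hK : K.Acyclic) (i j : ℤ) (hij : i + 1 = j) :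
    (ShortComplex.mk (K.iCycles i) (K.toCycles i j) (by
      rw [← cancel_mono (K.iCycles j)]; simp)).ShortExact := by
  have : Epi (K.toCycles i j) :=
    Preadditive.epi_of_isZero_cokernel' _ (K.homologyIsCokernel i j (by simp; omega))
      ((hK j).isZero_homology)
  refine { exact := ?_, mono_f := by dsimp; infer_instance, epi_g := this }
  rw [ShortComplex.exact_iff_exact_up_to_refinements]
  intro A x hx
  dsimp at x hx ⊢
  have hx' : x ≫ K.d i j = 0 := by
    rw [← K.toCycles_i i j, reassoc_of% hx, zero_comp]
  exact ⟨A, 𝟙 _, inferInstance, K.liftCycles x j (by simp; omega) hx', by simp⟩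

lemma rd_zero [HasInjectiveResolutions B] (p : ℕ) (hp : 0 < p) (X : B) (hX : IsZero X) :
    IsZero ((G.rightDerived p).obj X) := by
  obtain ⟨n, rfl⟩ : ∃ n, p = n + 1 := ⟨p - 1, by omega⟩
  have : Injective X := hX.injective
  exact Functor.isZero_rightDerived_obj_injective_succ G n X

include hT in
lemma acyclic_cycles (K : CochainComplex B ℤ) (hK : K.Acyclic) (a : ℤ) [K.IsStrictlyGE a]
    (hA : ∀ i (p : ℕ), 0 < p → IsZero ((G.rightDerived p).obj (K.X i))) (i : ℤ) (p : ℕ) 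
    (hp : 0 < p) : IsZero ((G.rightDerived p).obj (K.cycles i)) := by
  have key : ∀ (n : ℕ) (p : ℕ), 0 < p → IsZero ((G.rightDerived p).obj (K.cycles (a - 1 + n))) := by
    intro n
    induction n with
    | zero =>
      intro p hp
      refine rd_zero G p hp _ ?_
      refine IsZero.of_mono (K.iCycles _) (K.isZero_of_isStrictlyGE a _ (by simp))
    | succ n ih =>
      exact acyclic_of_ses G T hT _ (cycles_ses K hK (a - 1 + n) (a - 1 + (n + 1 : ℕ)) 
        (by push_cast; ring)) ih (hA _)
  by_cases hi : a ≤ i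
  · obtain ⟨n, rfl⟩ : ∃ n : ℕ, i = a - 1 + n := ⟨(i - a + 1).toNat, by omega⟩
    exact key n p hp
  · refine rd_zero G p hp _ ?_
    refine IsZero.of_mono (K.iCycles _) (K.isZero_of_isStrictlyGE a _ (by omega))

include hT in
lemma map_acyclic (K : CochainComplex B ℤ) (hK : K.Acyclic) (a : ℤ) [K.IsStrictlyGE a]
    (hA : ∀ i (p : ℕ), 0 < p → IsZero ((G.rightDerived p).obj (K.X i))) :
    ((G.mapHomologicalComplex (.up ℤ)).obj K).Acyclic := by
  intro j
  rw [HomologicalComplex.exactAt_iff' _ (j - 1) j (j + 1) (by simp) (by simp)]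
  have hepi := epi_of_acyclic G _ (cycles_ses K hK (j - 1) j (by simp))
    (acyclic_cycles G T hT K hK a hA _ 1 (by simp))
  have hex : (ShortComplex.mk (K.iCycles j) (K.d j (j + 1)) (by simp)).Exact :=
    ShortComplex.exact_of_f_is_kernel _ (K.cyclesIsKernel j (j + 1) (by simp))
  have hex' := hex.map_of_mono_of_preservesKernel G inferInstance inferInstance
  have h1 : G.map (K.d (j - 1) j) = G.map (K.toCycles (j - 1) j) ≫ G.map (K.iCycles j) := by
    rw [← G.map_comp]; simp
  rw [ShortComplex.exact_iff_exact_up_to_refinements] at hex' ⊢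
  intro A x hx
  obtain ⟨A₁, π₁, _, y, hy⟩ := hex' x hx
  obtain ⟨A₂, π₂, _, z, hz⟩ := (epi_iff_surjective_up_to_refinements _).1 hepi y
  refine ⟨A₂, π₂ ≫ π₁, inferInstance, z, ?_⟩
  refine Eq.trans ?_ (congrArg (fun t => z ≫ t) h1).symm
  refine Eq.trans ?_ (Category.assoc _ _ _)
  refine Eq.trans ?_ (congrArg (fun t => t ≫ G.map (K.iCycles j)) hz)
  refine (Category.assoc _ _ _).trans ?_
  refine Eq.trans ?_ (Category.assoc _ _ _).symm
  exact congrArg (fun t => π₂ ≫ t) hy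
end

end GSS

namespace GSS

open Pretriangulated

section
variable {B : Type*} [Category B] [Abelian B]

lemma quasiIso_iff_cone {K L : CochainComplex B ℤ} (f : K ⟶ L) :
    QuasiIso f ↔ (CochainComplex.mappingCone f).Acyclic := by
  rw [← HomologicalComplex.mem_quasiIso_iff, ← HomotopyCategory.quotient_map_mem_quasiIso_iff,
    HomotopyCategory.quasiIso_eq_trW_subcategoryAcyclic]
  exact ((HomotopyCategory.subcategoryAcyclic B).trW_iff_of_distinguished _
      (HomotopyCategory.mappingCone_triangleh_distinguished f)).trans
    (HomotopyCategory.quotient_obj_mem_subcategoryAcyclic_iff_acyclic _)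

lemma cone_ses {K L : CochainComplex B ℤ} (f : K ⟶ L) (n : ℤ) :
    (ShortComplex.mk ((CochainComplex.mappingCone.inr f).f n) 
      ((CochainComplex.mappingCone.fst f).1.v n (n + 1) rfl) (by simp)).ShortExact := by
  refine ShortComplex.Splitting.shortExact
    { r := (CochainComplex.mappingCone.snd f).v n n (add_zero n)
      s := (CochainComplex.mappingCone.inl f).v (n + 1) n (by omega)
      f_r := by simp
      s_g := by simp
      id := ?_ }
  dsimp
  rw [← CochainComplex.mappingCone.id_X f n (n + 1) rfl, add_comm]
end

section
variable {B C : Type*} [Category B] [Abelian B] [Category C] [Abelian C]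
  [HasDerivedCategory B] (G : B ⥤ C) [G.Additive] [EnoughInjectives B]
  (T : DerivedCategory.Plus B ⥤ HomotopyCategory C (.up ℤ))
  [T.CommShift ℤ] [T.IsTriangulated]
  (hT : Nonempty (Phi B ⋙ T ≅ Psi G))

include hT in
lemma acyclic_of_ses' (S : ShortComplex B) (hS : S.ShortExact)
    (h1 : ∀ p : ℕ, 0 < p → IsZero ((G.rightDerived p).obj S.X₁))
    (h3 : ∀ p : ℕ, 0 < p → IsZero ((G.rightDerived p).obj S.X₃))
    (p : ℕ) (hp : 0 < p) : IsZero ((G.rightDerived p).obj S.X₂) := by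
  obtain ⟨W, g, h, mem⟩ := distinguished_cocone_triangle
    ((DerivedCategory.Plus.singleFunctor B 0).map S.f)
  have mem' := DerivedCategory.Plus.ι.map_distinguished _ mem
  have e : W.obj ≅ (DerivedCategory.singleFunctor B 0).obj S.X₃ :=
    Triangle.π₃.mapIso (isoTriangleOfIso₁₂ _ _ mem' hS.singleTriangle_distinguished
      (Iso.refl _) (Iso.refl _) 
      ((Category.comp_id _).trans (Category.id_comp _).symm))
  obtain ⟨e3⟩ := T_single G T hT W S.X₃ 0 e p p (by simp)
  obtain ⟨e2⟩ := T_single G T hT ((DerivedCategory.Plus.singleFunctor B 0).obj S.X₂) S.X₂ 0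
      (Iso.refl _) p p (by simp)
  obtain ⟨e1⟩ := T_single G T hT ((DerivedCategory.Plus.singleFunctor B 0).obj S.X₁) S.X₁ 0
      (Iso.refl _) p p (by simp)
  refine IsZero.of_iso ?_ e2.symm
  let H := HomotopyCategory.homologyFunctor C (.up ℤ) 0
  have ex := H.homologySequence_exact₂ _ (T.map_distinguished _ mem) (p : ℤ)
  refine ex.isZero_of_both_zeros (IsZero.eq_of_src ?_ _ _) (IsZero.eq_of_tgt ?_ _ _)
  · exact (h1 p hp).of_iso e1
  · exact (h3 p hp).of_iso e3

variable [PreservesFiniteLimits G]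

include hT in
lemma T_acyclic (K : CochainComplex B ℤ) [K.IsStrictlyGE 0]
    (hA : ∀ i (p : ℕ), 0 < p → IsZero ((G.rightDerived p).obj (K.X i)))
    (X : DerivedCategory.Plus B) (e : DerivedCategory.Q.obj K ≅ X.obj) (n : ℤ) :
    Nonempty ((HomotopyCategory.homologyFunctor C (.up ℤ) n).obj (T.obj X) ≅
      ((G.mapHomologicalComplex (.up ℤ)).obj K).homology n) := by
  obtain ⟨J, i, hi, hJ, hJ0⟩ := 
    CochainComplex.Plus.modelCategoryQuillen.exists_quasiIso_injective K 0
  obtain ⟨e1⟩ := T_homology' G T hT J 0 hJ X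
    ((asIso (DerivedCategory.Q.map i)).symm ≪≫ e) n
  have hc := (quasiIso_iff_cone i).1 hi
  have : (CochainComplex.mappingCone i).IsStrictlyGE (-1) :=
    CochainComplex.isStrictlyGE_mappingCone i 0 0 (-1)
  have hGc := map_acyclic G T hT _ hc (-1) (fun n => by
    refine acyclic_of_ses' G T hT _ (cone_ses i n) ?_ ?_
    · intro p hp
      obtain ⟨m, rfl⟩ : ∃ m, p = m + 1 := ⟨p - 1, by omega⟩
      exact Functor.isZero_rightDerived_obj_injective_succ G m (J.X n)
    · exact hA _)
  have hq : QuasiIso ((G.mapHomologicalComplex (.up ℤ)).map i) := by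
    rw [quasiIso_iff_cone]
    intro n
    exact (hGc n).of_iso (CochainComplex.mappingCone.mapHomologicalComplexIso i G)
  exact ⟨e1 ≪≫ (asIso (HomologicalComplex.homologyMap 
    ((G.mapHomologicalComplex (.up ℤ)).map i) n)).symm⟩

end

end GSS

namespace GSS

lemma succ_le_of_lt' (n : ℤ) (i : EInt) (h : co n < i) : co (n + 1) ≤ i := by
  induction i using WithBotTop.rec with
  | bot => exact absurd h not_lt_bot
  | coe m =>
    simp at h ⊢
    omega
  | top => exact le_top

open Pretriangulated ComposableArrows

section
variable {B C : Type*} [Category B] [Abelian B] [Category C] [Abelian C]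
  [HasDerivedCategory B] (G : B ⥤ C) [G.Additive] [EnoughInjectives B]
  (T : DerivedCategory.Plus B ⥤ HomotopyCategory C (.up ℤ))
  [T.CommShift ℤ] [T.IsTriangulated]
  (hT : Nonempty (Phi B ⋙ T ≅ Psi G))

noncomputable abbrev SO (X : DerivedCategory.Plus B) : Abelian.SpectralObject C EInt :=
  homObj (HomotopyCategory.homologyFunctor C (.up ℤ) 0)
    ((DerivedCategory.Plus.TStructure.t.spectralObject X).mapTriangulatedFunctor T)

noncomputable abbrev W (X : DerivedCategory.Plus B) (i j : EInt) : DerivedCategory.Plus B :=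
  (DerivedCategory.Plus.TStructure.t.eTruncGE.obj i).obj
    ((DerivedCategory.Plus.TStructure.t.eTruncLT.obj j).obj X)

noncomputable def SO_iso (X : DerivedCategory.Plus B) (i j : EInt) (hij : i ≤ j) (n : ℤ) :
    ((SO T X).H n).obj (mk₁ (homOfLE hij)) ≅
      (HomotopyCategory.homologyFunctor C (.up ℤ) n).obj (T.obj (W X i j)) := Iso.refl _

include hT in
lemma SO_firstQuadrant (X : DerivedCategory.Plus B) [X.IsGE 0] : (SO T X).IsFirstQuadrant where
  isZero₁ i j hij hj n := by
    refine IsZero.of_iso ?_ (SO_iso T X i j hij n)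
    refine Functor.map_isZero _ (T.map_isZero ?_)
    exact Functor.map_isZero _
      (DerivedCategory.Plus.TStructure.t.isZero_eTruncLT_obj_obj X 0 j hj)
  isZero₂ i j hij n hi := by
    refine IsZero.of_iso ?_ (SO_iso T X i j hij n)
    have : (W X i j).IsGE (n + 1) := 
      DerivedCategory.Plus.TStructure.t.isGE_eTruncGE_obj_obj (n + 1) i
        (succ_le_of_lt' n i hi) _
    exact T_vanish G T hT _ (n + 1) n (by omega)

omit [EnoughInjectives B] in
lemma hIso₁ (Y : Triangle (DerivedCategory.Plus B)) (hY : Y ∈ distTriang _) (n m : ℤ)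
    (hm : m + 1 = n)
    (h1 : IsZero ((DerivedCategory.Plus.homologyFunctor B m).obj Y.obj₃))
    (h2 : IsZero ((DerivedCategory.Plus.homologyFunctor B n).obj Y.obj₃)) :
    Nonempty ((DerivedCategory.Plus.homologyFunctor B n).obj Y.obj₁ ≅
      (DerivedCategory.Plus.homologyFunctor B n).obj Y.obj₂) := by
  let H := DerivedCategory.Plus.homologyFunctor B 0
  have := (H.homologySequence_epi_shift_map_mor₁_iff _ hY n).2 (h2.eq_of_tgt _ _)
  have := (H.homologySequence_mono_shift_map_mor₁_iff _ hY m n hm).2 (h1.eq_of_src _ _)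
  have := isIso_of_mono_of_epi ((H.shift n).map Y.mor₁)
  have e := asIso ((H.shift n).map Y.mor₁)
  exact ⟨e⟩

omit [EnoughInjectives B] in
lemma hIso₂ (Y : Triangle (DerivedCategory.Plus B)) (hY : Y ∈ distTriang _) (n m : ℤ)
    (hm : n + 1 = m)
    (h1 : IsZero ((DerivedCategory.Plus.homologyFunctor B m).obj Y.obj₁))
    (h2 : IsZero ((DerivedCategory.Plus.homologyFunctor B n).obj Y.obj₁)) :
    Nonempty ((DerivedCategory.Plus.homologyFunctor B n).obj Y.obj₂ ≅
      (DerivedCategory.Plus.homologyFunctor B n).obj Y.obj₃) := by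
  let H := DerivedCategory.Plus.homologyFunctor B 0
  have := (H.homologySequence_epi_shift_map_mor₂_iff _ hY n m hm).2 (h1.eq_of_tgt _ _)
  have := (H.homologySequence_mono_shift_map_mor₂_iff _ hY n).2 (h2.eq_of_src _ _)
  have := isIso_of_mono_of_epi ((H.shift n).map Y.mor₂)
  have e := asIso ((H.shift n).map Y.mor₂)
  exact ⟨e⟩

omit [EnoughInjectives B] in
lemma W_homology (X : DerivedCategory.Plus B) (q : ℤ) :
    Nonempty ((DerivedCategory.Plus.homologyFunctor B q).obj X ≅
      (DerivedCategory.Plus.homologyFunctor B q).obj (W X (co q) (co (q + 1)))) := by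
  let t : Triangulated.TStructure (DerivedCategory.Plus B) := DerivedCategory.Plus.TStructure.t
  let Z := (t.eTruncLT.obj (co (q + 1))).obj X
  have h3 : ((t.eTruncGE.obj (co (q + 1))).obj X).IsGE (q + 1) :=
    t.isGE_eTruncGE_obj_obj (q + 1) _ le_rfl X
  have h1 : ((t.eTruncLT.obj (co q)).obj Z).IsLE (q - 1) :=
    t.isLE_eTruncLT_obj_obj (q - 1) _ (by simp) Z
  obtain ⟨e1⟩ := hIso₁ _ (t.eTriangleLTGE_distinguished (co (q + 1)) X) q (q - 1) (by omega)
    (DerivedCategory.Plus.isZero_homology_of_isGE 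
      ((t.eTruncGE.obj (co (q + 1))).obj X) (q + 1) _ (by omega))
    (DerivedCategory.Plus.isZero_homology_of_isGE 
      ((t.eTruncGE.obj (co (q + 1))).obj X) (q + 1) _ (by omega))
  obtain ⟨e2⟩ := hIso₂ _ (t.eTriangleLTGE_distinguished (co q) Z) q (q + 1) (by omega)
    (DerivedCategory.Plus.isZero_homology_of_isLE
      ((t.eTruncLT.obj (co q)).obj Z) (q - 1) _ (by omega))
    (DerivedCategory.Plus.isZero_homology_of_isLE
      ((t.eTruncLT.obj (co q)).obj Z) (q - 1) _ (by omega))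
  exact ⟨e1.symm ≪≫ e2⟩

omit [EnoughInjectives B] in
lemma W_single (X : DerivedCategory.Plus B) (q : ℤ) :
    Nonempty ((W X (co q) (co (q + 1))).obj ≅ (DerivedCategory.singleFunctor B q).obj
      ((DerivedCategory.homologyFunctor B q).obj X.obj)) := by
  let t : Triangulated.TStructure (DerivedCategory.Plus B) := DerivedCategory.Plus.TStructure.t
  let V := W X (co q) (co (q + 1))
  have h1 : V.IsGE q := t.isGE_eTruncGE_obj_obj q _ le_rfl _
  have h2' : ((t.eTruncLT.obj (co (q + 1))).obj X).IsLE q :=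
    t.isLE_eTruncLT_obj_obj q _ le_rfl X
  have h2 : V.IsLE q := inferInstanceAs 
    (t.IsLE ((t.eTruncGE.obj (co q)).obj ((t.eTruncLT.obj (co (q + 1))).obj X)) q)
  have h1' : V.obj.IsGE q := inferInstanceAs ((DerivedCategory.Plus.ι.obj V).IsGE q)
  have h2' : V.obj.IsLE q := inferInstanceAs ((DerivedCategory.Plus.ι.obj V).IsLE q)
  obtain ⟨Y, ⟨e⟩⟩ := DerivedCategory.exists_iso_singleFunctor_obj_of_isGE_of_isLE V.obj q
  obtain ⟨f⟩ := W_homology X q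
  have e2 : (DerivedCategory.homologyFunctor B q).obj ((DerivedCategory.singleFunctor B q).obj Y)
      ≅ Y := (DerivedCategory.homologyFunctorFactors B q).app _ ≪≫
        HomologicalComplex.singleObjHomologySelfIso (.up ℤ) q Y
  have e3 : (DerivedCategory.homologyFunctor B q).obj X.obj ≅ Y :=
    f ≪≫ (DerivedCategory.homologyFunctor B q).mapIso e ≪≫ e2
  exact ⟨e ≪≫ (DerivedCategory.singleFunctor B q).mapIso e3.symm⟩

end

section
variable {A B C : Type*} [Category A] [Category B] [Category C] [Abelian A] [Abelian B] [Abelian C]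
  [EnoughInjectives A] [EnoughInjectives B]
  (F : A ⥤ B) (G : B ⥤ C) [F.Additive] [G.Additive] [PreservesFiniteLimits G]

lemma rightDerived_iso {M N : B} (e : M ≅ N) (p : ℕ) :
    Nonempty ((G.rightDerived p).obj M ≅ (G.rightDerived p).obj N) := 
  ⟨(G.rightDerived p).mapIso e⟩

theorem main (hacyclic : ∀ (I : A), Injective I → ∀ (p : ℕ), 0 < p →
      IsZero ((G.rightDerived p).obj (F.obj I))) (A₀ : A) :
    Nonempty (ConvergentFirstQuadrantSpectralSequence
      (fun p q => (G.rightDerived p).obj ((F.rightDerived q).obj A₀))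
      (fun n => ((F ⋙ G).rightDerived n).obj A₀)) := by
  let : HasDerivedCategory B := HasDerivedCategory.standard B
  obtain ⟨T, _, _, hT⟩ := exists_RG G
  let I := injectiveResolution A₀
  let K : CochainComplex B ℤ := (F.mapHomologicalComplex (.up ℤ)).obj I.cochainComplex
  have hK : K.IsStrictlyGE 0 := inferInstance
  have hKge : DerivedCategory.TStructure.t.IsGE (DerivedCategory.Q.obj K) 0 :=
    inferInstanceAs ((DerivedCategory.Q.obj K).IsGE 0)
  let X : DerivedCategory.Plus B := ⟨DerivedCategory.Q.obj K, 0, hKge⟩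
  have hX : X.IsGE 0 := (DerivedCategory.Plus.isGE_ι_obj_iff X 0).1 hKge
  have hKA : ∀ i (p : ℕ), 0 < p → IsZero ((G.rightDerived p).obj (K.X i)) := fun i p hp =>
    hacyclic (I.cochainComplex.X i) inferInstance p hp
  have := SO_firstQuadrant G T hT X
  refine spectral_of_object (SO T X) _ _ ?_ ?_
  · intro p q
    obtain ⟨e⟩ := W_single X q
    obtain ⟨e1⟩ := T_single G T hT _ _ q e p (p + q) rfl
    have e2 : (DerivedCategory.homologyFunctor B q).obj X.obj ≅ (F.rightDerived q).obj A₀ :=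
      (DerivedCategory.homologyFunctorFactors B q).app K ≪≫ derivedIso F I q
    exact ⟨SO_iso T X _ _ _ _ ≪≫ e1 ≪≫ (G.rightDerived p).mapIso e2⟩
  · intro n
    obtain ⟨e⟩ := T_acyclic G T hT K hKA X (Iso.refl _) n
    exact ⟨SO_iso T X ⊥ ⊤ bot_le n ≪≫ e ≪≫ derivedIso (F ⋙ G) I n⟩
end

end GSS

/-- **Grothendieck spectral sequence.** Let `F : A ⥤ B`, `G : B ⥤ C` be left exact
(additive) functors between abelian categories, where `A` and `B` have enough
injectives and `F` carries injective objects of `A` to `G`-acyclic objects of `B`.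
Then for every `A₀` in `A` there is a convergent first-quadrant spectral sequence
`E₂^{p,q} = R^p G (R^q F (A₀)) ⇒ R^{p+q}(G ∘ F)(A₀)`. -/
theorem grothendieck_spectral_sequence
    {A : Type*} {B : Type*} {C : Type*}
    [Category A] [Category B] [Category C]
    [Abelian A] [Abelian B] [Abelian C]
    [EnoughInjectives A] [EnoughInjectives B]
    (F : A ⥤ B) (G : B ⥤ C) [F.Additive] [G.Additive]
    [PreservesFiniteLimits F] [PreservesFiniteLimits G]
    (hacyclic : ∀ (I : A), Injective I → ∀ (p : ℕ), 0 < p →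
      IsZero ((G.rightDerived p).obj (F.obj I)))
    (A₀ : A) :
    Nonempty (ConvergentFirstQuadrantSpectralSequence
      (fun p q => (G.rightDerived p).obj ((F.rightDerived q).obj A₀))
      (fun n => ((F ⋙ G).rightDerived n).obj A₀)) := by
  exact GSS.main F G hacyclic A₀
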